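/- arXiv:2201.13381 — 2 statements merged into one kernel-verified Lean document; each statement's English description precedes it below -/
import Mathlib

section
/- Let φ : ℂ[x,y,z,u] → ℂ[x₁,x₂,x₃,x₄] be the ℂ-algebra homomorphism determined by φ(x)=x₁x₃, φ(y)=x₁x₄, φ(z)=x₂x₃, φ(u)=x₂x₄. Then the image of φ equals the subalgebra of ℂ*-invariant polynomials, i.e. the set of f ∈ ℂ[x₁,x₂,x₃,x₄] such that for every t ∈ ℂ with t ≠ 0 and every (v₁,v₂,v₃,v₄) ∈ ℂ⁴ one has f(t⁻¹v₁, t⁻¹v₂, t v₃, t v₄) = f(v₁,v₂,v₃,v₄). -/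
open MvPolynomial

/-- The ℂ-algebra homomorphism ℂ[x,y,z,u] → ℂ[x₁,x₂,x₃,x₄] determined by
x ↦ x₁x₃, y ↦ x₁x₄, z ↦ x₂x₃, u ↦ x₂x₄ (variables indexed by `Fin 4`). -/
noncomputable def conifoldHom : MvPolynomial (Fin 4) ℂ →ₐ[ℂ] MvPolynomial (Fin 4) ℂ :=
  aeval ![X 0 * X 2, X 0 * X 3, X 1 * X 2, X 1 * X 3]

/-- The action of t ∈ ℂ* on ℂ⁴ with weights (−1,−1,1,1):
t·(v₁,v₂,v₃,v₄) = (t⁻¹v₁, t⁻¹v₂, t v₃, t v₄). -/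
noncomputable def torusAct (t : ℂ) (v : Fin 4 → ℂ) : Fin 4 → ℂ :=
  ![t⁻¹ * v 0, t⁻¹ * v 1, t * v 2, t * v 3]

/-- Rescaling the variables of a polynomial rescales each coefficient by the matching monomial. -/
lemma coeff_aeval_C_mul_X {σ R : Type*} [CommSemiring R] (c : σ → R) (f : MvPolynomial σ R)
    (d : σ →₀ ℕ) :
    coeff d (aeval (fun i => C (c i) * X i : σ → MvPolynomial σ R) f) =
      (d.prod fun i k => c i ^ k) * coeff d f := by
  classical
  induction f using MvPolynomial.induction_on' with
  | monomial e a =>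
    have h : aeval (fun i => C (c i) * X i : σ → MvPolynomial σ R) (monomial e a) =
        monomial e ((e.prod fun i k => c i ^ k) * a) := by
      rw [aeval_monomial, monomial_eq, algebraMap_eq, C_mul]
      simp only [mul_pow, Finsupp.prod, Finset.prod_mul_distrib, map_prod, map_pow]
      ring
    rw [h, coeff_monomial, coeff_monomial]
    split_ifs with hd
    · rw [hd]
    · rw [mul_zero]
  | add p q hp hq => rw [map_add, coeff_add, coeff_add, hp, hq, mul_add]

lemma torus_weight_eq_of_invariant {f : MvPolynomial (Fin 4) ℂ}
    (hf : ∀ t : ℂ, t ≠ 0 → ∀ v : Fin 4 → ℂ, eval (torusAct t v) f = eval v f)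
    {d : Fin 4 →₀ ℕ} (hd : coeff d f ≠ 0) : d 0 + d 1 = d 2 + d 3 := by
  let c : Fin 4 → ℂ := ![2⁻¹, 2⁻¹, 2, 2]
  have hc : aeval (fun i => C (c i) * X i : Fin 4 → MvPolynomial (Fin 4) ℂ) f = f := by
    refine MvPolynomial.funext fun v => ?_
    rw [← hf 2 two_ne_zero v]
    change eval v (bind₁ _ f) = _
    rw [← coe_aeval_eq_eval, RingHom.coe_coe, aeval_bind₁, ← coe_aeval_eq_eval, RingHom.coe_coe]
    congr 2
    funext i
    fin_cases i <;> simp [c, torusAct]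
  have h := coeff_aeval_C_mul_X c f d
  rw [hc] at h
  have h1 : (d.prod fun i k => c i ^ k) = 1 := (mul_eq_right₀ hd).mp h.symm
  rw [Finsupp.prod_fintype _ _ fun i => pow_zero _, Fin.prod_univ_four] at h1
  simp only [c, Matrix.cons_val, inv_pow] at h1
  have h2 : (2 : ℂ) ^ (d 2 + d 3) = 2 ^ (d 0 + d 1) := by
    rw [pow_add, pow_add]
    field_simp at h1
    linear_combination h1
  have h3 : 2 ^ (d 2 + d 3) = 2 ^ (d 0 + d 1) := by exact_mod_cast h2
  exact (Nat.pow_right_injective le_rfl h3).symm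

lemma X_mul_X_mem_range_conifoldHom {i j : Fin 4} (hi : i = 0 ∨ i = 1) (hj : j = 2 ∨ j = 3) :
    (X i * X j : MvPolynomial (Fin 4) ℂ) ∈ conifoldHom.range := by
  rw [AlgHom.mem_range]
  rcases hi with rfl | rfl <;> rcases hj with rfl | rfl
  · exact ⟨X 0, by simp [conifoldHom]⟩
  · exact ⟨X 1, by simp [conifoldHom]⟩
  · exact ⟨X 2, by simp [conifoldHom]⟩
  · exact ⟨X 3, by simp [conifoldHom]⟩

lemma X_pow_mem_range_conifoldHom (n : ℕ) : ∀ a b c d : ℕ, a + b = n → c + d = n →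
    (X 0 ^ a * X 1 ^ b * X 2 ^ c * X 3 ^ d : MvPolynomial (Fin 4) ℂ) ∈ conifoldHom.range := by
  induction n with
  | zero =>
    intro a b c d h h'
    obtain ⟨rfl, rfl⟩ : a = 0 ∧ b = 0 := by omega
    obtain ⟨rfl, rfl⟩ : c = 0 ∧ d = 0 := by omega
    simp
  | succ n ih =>
    intro a b c d h h'
    have key (i j : Fin 4) (hi : i = 0 ∨ i = 1) (hj : j = 2 ∨ j = 3) (a b c d : ℕ)
        (h : a + b = n) (h' : c + d = n) :=
      mul_mem (X_mul_X_mem_range_conifoldHom hi hj) (ih a b c d h h')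
    rcases a with _ | a <;> rcases c with _ | c
    · obtain ⟨rfl, rfl⟩ : b = n + 1 ∧ d = n + 1 := by omega
      convert key 1 3 (by simp) (by simp) 0 n 0 n (by omega) (by omega) using 1
      ring
    · obtain rfl : b = n + 1 := by omega
      convert key 1 2 (by simp) (by simp) 0 n c d (by omega) (by omega) using 1
      ring
    · obtain rfl : d = n + 1 := by omega
      convert key 0 3 (by simp) (by simp) a b 0 n (by omega) (by omega) using 1
      ring
    · convert key 0 2 (by simp) (by simp) a b c d (by omega) (by omega) using 1
      ring

/-- The image of the homomorphism x ↦ x₁x₃, y ↦ x₁x₄, z ↦ x₂x₃, u ↦ x₂x₄ is exactly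
the set of polynomials invariant under the ℂ*-action with weights (−1,−1,1,1). -/
theorem conifold_range :
    (conifoldHom.range : Set (MvPolynomial (Fin 4) ℂ)) =
      {f : MvPolynomial (Fin 4) ℂ |
        ∀ t : ℂ, t ≠ 0 → ∀ v : Fin 4 → ℂ, eval (torusAct t v) f = eval v f} := by
  ext f
  simp only [SetLike.mem_coe, Set.mem_ofPred_eq]
  constructor
  · rintro ⟨g, rfl⟩ t ht v
    change eval _ (bind₁ _ g) = eval _ (bind₁ _ g)
    rw [← coe_aeval_eq_eval, ← coe_aeval_eq_eval, RingHom.coe_coe, RingHom.coe_coe,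
      aeval_bind₁, aeval_bind₁]
    congr 2
    funext i
    fin_cases i <;> simp [torusAct] <;> field_simp
  · intro hf
    rw [f.as_sum]
    refine sum_mem fun d hd => ?_
    have hw := torus_weight_eq_of_invariant hf (mem_support_iff.mp hd)
    rw [monomial_eq, Finsupp.prod_fintype _ _ fun i => pow_zero _, Fin.prod_univ_four]
    exact mul_mem (conifoldHom.range.algebraMap_mem _)
      (X_pow_mem_range_conifoldHom _ _ _ _ _ hw rfl)
end

section
/- Let a, b, c ∈ ℂ and let U ⊆ ℂ⁴ be an open set all of whose points have all four coordinates nonzero. Suppose Φ : U → ℂ is holomorphic and satisfies on U the conifold GKZ system with parameter α = (c−1, −a, −b): (−x₁∂₁ + x₂∂₂)Φ = (c−1)Φ, (x₁∂₁ + x₃∂₃)Φ = −aΦ, (x₁∂₁ + x₄∂₄)Φ = −bΦ, and ∂₁∂₂Φ = ∂₃∂₄Φ. Let V ⊆ ℂ∖{0} be open with (x,1,1,1) ∈ U for all x ∈ V, and define F : V → ℂ by F(x) = Φ(x,1,1,1). Then F satisfies the Gauss hypergeometric equation x(1−x)F″(x) + (c − (a+b+1)x)F′(x) − ab·F(x)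 = 0 for all x ∈ V. -/
/-- The partial derivative in the `i`-th coordinate of a function on ℂ⁴. -/
noncomputable def pderiv4 (i : Fin 4) (Φ : (Fin 4 → ℂ) → ℂ) : (Fin 4 → ℂ) → ℂ :=
  fun x => fderiv ℂ Φ x (Pi.single i 1)

theorem analyticAt_pderiv4 {Φ : (Fin 4 → ℂ) → ℂ} {x : Fin 4 → ℂ} (h : AnalyticAt ℂ Φ x)
    (i : Fin 4) : AnalyticAt ℂ (pderiv4 i Φ) x :=
  ((ContinuousLinearMap.apply ℂ ℂ (Pi.single i 1 : Fin 4 → ℂ)).analyticAt _).comp h.fderiv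

theorem pderiv4_comm {Φ : (Fin 4 → ℂ) → ℂ} {x : Fin 4 → ℂ} (h : AnalyticAt ℂ Φ x)
    (i j : Fin 4) : pderiv4 i (pderiv4 j Φ) x = pderiv4 j (pderiv4 i Φ) x := by
  have key : ∀ i j : Fin 4, pderiv4 i (pderiv4 j Φ) x
      = fderiv ℂ (fderiv ℂ Φ) x (Pi.single i 1) (Pi.single j 1) := by
    intro i j
    have hd : HasFDerivAt (pderiv4 j Φ) _ x :=
      h.fderiv.differentiableAt.hasFDerivAt.clm_apply
        (hasFDerivAt_const (Pi.single j 1 : Fin 4 → ℂ) x)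
    simp [pderiv4, hd.fderiv]
  rw [key, key]
  exact (h.contDiffAt (n := 2)).isSymmSndFDerivAt (by simp) _ _

/-- Differentiating a first-order Euler relation in the `j`-th coordinate. -/
theorem pderiv4_euler {U : Set (Fin 4 → ℂ)} (hU : IsOpen U) {f g h : (Fin 4 → ℂ) → ℂ}
    {s m : ℂ} {i k : Fin 4}
    (heq : ∀ x ∈ U, s * x i * g x + x k * h x = m * f x) {x : Fin 4 → ℂ} (hx : x ∈ U)
    (hf : DifferentiableAt ℂ f x) (hg : DifferentiableAt ℂ g x) (hh : DifferentiableAt ℂ h x)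
    (j : Fin 4) :
    s * ((Pi.single j 1 : Fin 4 → ℂ) i * g x + x i * pderiv4 j g x)
      + ((Pi.single j 1 : Fin 4 → ℂ) k * h x + x k * pderiv4 j h x) = m * pderiv4 j f x := by
  have hc : ∀ l : Fin 4, HasFDerivAt (fun y : Fin 4 → ℂ => y l)
      (ContinuousLinearMap.proj (R := ℂ) (φ := fun _ : Fin 4 => ℂ) l) x :=
    fun l => hasFDerivAt_apply l x
  have hL := (((hc i).const_mul s).mul hg.hasFDerivAt).add ((hc k).mul hh.hasFDerivAt)
  have hR := hf.hasFDerivAt.const_mul m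
  have hLR := hR.congr_of_eventuallyEq (Filter.eventually_of_mem (hU.mem_nhds hx) heq)
  have := congrArg (fun L => L (Pi.single j 1 : Fin 4 → ℂ)) (hL.unique hLR)
  simp only [add_apply, smul_apply,
    ContinuousLinearMap.proj_apply, smul_eq_mul] at this
  unfold pderiv4
  linear_combination this

theorem hasDerivAt_slice {Φ : (Fin 4 → ℂ) → ℂ} {z : ℂ}
    (h : DifferentiableAt ℂ Φ ![z, 1, 1, 1]) :
    HasDerivAt (fun t => Φ ![t, 1, 1, 1]) (pderiv4 0 Φ ![z, 1, 1, 1]) z := by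
  have hγ : HasDerivAt (fun t : ℂ => (![t, 1, 1, 1] : Fin 4 → ℂ)) (Pi.single 0 1) z := by
    rw [hasDerivAt_pi]
    intro i
    fin_cases i
    · simpa using hasDerivAt_id' z
    all_goals simpa using hasDerivAt_const z (1 : ℂ)
  exact h.hasFDerivAt.comp_hasDerivAt z hγ

/-- If a holomorphic function `Φ` on an open set `U ⊆ ℂ⁴` (all of whose points have
all coordinates nonzero) satisfies the conifold GKZ system with parameter
α = (c−1, −a, −b), then its restriction `F(x) = Φ(x,1,1,1)` to the slice
x₂ = x₃ = x₄ = 1 satisfies the Gauss hypergeometric equation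
x(1−x)F″ + (c − (a+b+1)x)F′ − ab·F = 0. -/
theorem conifold_gkz_restrict_gauss (a b c : ℂ) (U : Set (Fin 4 → ℂ)) (hU : IsOpen U)
    (hne : ∀ x ∈ U, ∀ i : Fin 4, x i ≠ 0)
    (Φ : (Fin 4 → ℂ) → ℂ) (hΦ : AnalyticOnNhd ℂ Φ U)
    (h1 : ∀ x ∈ U, -(x 0) * pderiv4 0 Φ x + x 1 * pderiv4 1 Φ x = (c - 1) * Φ x)
    (h2 : ∀ x ∈ U, x 0 * pderiv4 0 Φ x + x 2 * pderiv4 2 Φ x = -a * Φ x)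
    (h3 : ∀ x ∈ U, x 0 * pderiv4 0 Φ x + x 3 * pderiv4 3 Φ x = -b * Φ x)
    (h4 : ∀ x ∈ U, pderiv4 0 (pderiv4 1 Φ) x = pderiv4 2 (pderiv4 3 Φ) x)
    (V : Set ℂ) (hV : IsOpen V) (hV0 : (0 : ℂ) ∉ V)
    (hVU : ∀ x ∈ V, (![x, 1, 1, 1] : Fin 4 → ℂ) ∈ U)
    (F : ℂ → ℂ) (hF : ∀ x, F x = Φ ![x, 1, 1, 1]) :
    ∀ x ∈ V,
      x * (1 - x) * deriv (deriv F) x + (c - (a + b + 1) * x) * deriv F x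
        - a * b * F x = 0 := by
  intro z hz
  have hp := hVU z hz
  have hA := hΦ _ hp
  have hd := fun i => (analyticAt_pderiv4 hA i).differentiableAt
  have hFd : ∀ t ∈ V, deriv F t = pderiv4 0 Φ ![t, 1, 1, 1] := fun t ht => by
    rw [funext hF]
    exact (hasDerivAt_slice (hΦ _ (hVU t ht)).differentiableAt).deriv
  have hFdd : deriv (deriv F) z = pderiv4 0 (pderiv4 0 Φ) ![z, 1, 1, 1] :=
    ((hasDerivAt_slice (hd 0)).congr_of_eventuallyEq
      (Filter.eventually_of_mem (hV.mem_nhds hz) hFd)).deriv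
  have e1 := pderiv4_euler hU (s := -1) (m := c - 1) (i := 0) (k := 1)
    (fun x hx => by linear_combination h1 x hx) hp hA.differentiableAt (hd 0) (hd 1) 0
  have e2 := pderiv4_euler hU (s := 1) (m := -a) (i := 0) (k := 2)
    (fun x hx => by linear_combination h2 x hx) hp hA.differentiableAt (hd 0) (hd 2) 0
  have e3 := pderiv4_euler hU (s := 1) (m := -b) (i := 0) (k := 3)
    (fun x hx => by linear_combination h3 x hx) hp hA.differentiableAt (hd 0) (hd 3) 2
  have e4 := h4 _ hp
  have e5 := h2 _ hp
  rw [pderiv4_comm hA 2 0] at e3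
  rw [hFdd, hFd z hz, hF z]
  simp at e1 e2 e3 e5
  linear_combination -e1 + e4 + e3 - z * e2 - b * e5
end
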